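/- arXiv:1309.5324 — 3 statements merged into one kernel-verified Lean document; each statement's English description precedes it below -/
import Mathlib

section
/- Bulk eigenvalue asymptotics (Theorem 1.1, bulk): Let F satisfy condition (F) and fix R > 0. Then there exists C > 0 such that for all C², 1-periodic α, β : ℝ → ℝ with zero mean and ‖α‖_{C²} ≤ R, ‖β‖_{C²} ≤ R, for every integer N ≥ 3, every integer ℓ with ⌊F(N)⌋ < ℓ < N − ⌊F(N)⌋, and n ∈ {2ℓ−1, 2ℓ}, the eigenvalues of Q^{α,β}_N satisfy |λ^N_n + 2 cos(ℓπ/N)| ≤ C N^{−2} F(N)^{−1}. -/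
open scoped Real

noncomputable section

/-- Condition (F) on the cut-off function `F`. -/
def ConditionF (F : ℕ → ℝ) : Prop :=
  (∀ N, 1 ≤ F N) ∧ Monotone F ∧ Filter.Tendsto F Filter.atTop Filter.atTop ∧
    ∃ η : ℝ, 0 < η ∧ η < 1 / 2 ∧ ∀ N : ℕ, 1 ≤ N → F N ≤ (N : ℝ) ^ η

/-- `f` is `C²`, 1-periodic and has zero mean. -/
def Admissible (f : ℝ → ℝ) : Prop :=
  ContDiff ℝ 2 f ∧ Function.Periodic f 1 ∧ (∫ x in (0:ℝ)..1, f x) = 0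

/-- `‖f‖_{C²} ≤ R`. -/
def C2NormLe (f : ℝ → ℝ) (R : ℝ) : Prop :=
  ∀ x, |f x| + |deriv f x| + |deriv (deriv f) x| ≤ R

/-- The `2N × 2N` periodic Jacobi matrix `Q^{α,β}_N` with diagonal entries
`b^N_j = (2N)⁻² β(j/N)` and off-diagonal entries `a^N_j = 1 + (2N)⁻² α(j/N)`,
indices taken mod `2N` (rows/columns `1,…,2N` realised as `Fin (2N)` via `j = i+1`). -/
def QMat (α β : ℝ → ℝ) (N : ℕ) : Matrix (Fin (2 * N)) (Fin (2 * N)) ℝ :=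
  Matrix.of fun i j =>
    if i = j then β (((i.val + 1 : ℕ) : ℝ) / N) / (4 * (N : ℝ) ^ 2)
    else if j.val = (i.val + 1) % (2 * N) then
      1 + α (((i.val + 1 : ℕ) : ℝ) / N) / (4 * (N : ℝ) ^ 2)
    else if i.val = (j.val + 1) % (2 * N) then
      1 + α (((j.val + 1 : ℕ) : ℝ) / N) / (4 * (N : ℝ) ^ 2)
    else 0

/-- `lam` lists the eigenvalues of `Q` in increasing order with multiplicities. -/
def IsEvalEnum {m : ℕ} (Q : Matrix (Fin m) (Fin m) ℝ) (lam : Fin m → ℝ) : Prop :=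
  Monotone lam ∧ Q.charpoly = ∏ i, (Polynomial.X - Polynomial.C (lam i))



section Abstract
variable {m : ℕ} {E : Type*} [NormedAddCommGroup E] [InnerProductSpace ℂ E]

lemma toda_inner_eig (u : OrthonormalBasis (Fin m) ℂ E) (A : E →ₗ[ℂ] E) (lam : Fin m → ℝ)
    (hA : ∀ i, A (u i) = (lam i : ℂ) • u i) (k : Fin m) (x : E) :
    inner ℂ (u k) (A x) = (lam k : ℂ) * inner ℂ (u k) x := by
  conv_lhs => rw [← u.sum_repr' x, map_sum]
  simp only [map_smul, hA, inner_sum, inner_smul_right]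
  rw [Finset.sum_eq_single k]
  · simp [inner_self_eq_norm_sq_to_K]; ring
  · intro b _ hb
    rw [u.inner_eq_zero hb.symm]; simp
  · simp

lemma toda_quad (u : OrthonormalBasis (Fin m) ℂ E) (A : E →ₗ[ℂ] E) (lam : Fin m → ℝ)
    (hA : ∀ i, A (u i) = (lam i : ℂ) • u i) (x : E) :
    (inner ℂ x (A x)).re = ∑ i, lam i * ‖inner ℂ (u i) x‖ ^ 2 := by
  rw [← u.sum_inner_mul_inner x (A x), Complex.re_sum]
  refine Finset.sum_congr rfl fun i _ => ?_
  rw [toda_inner_eig u A lam hA, ← inner_conj_symm x (u i)]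
  have : (starRingEnd ℂ) (inner ℂ (u i) x) * ((lam i : ℂ) * inner ℂ (u i) x)
      = ((lam i * ‖inner ℂ (u i) x‖ ^ 2 : ℝ) : ℂ) := by
    push_cast
    rw [← Complex.conj_mul']; ring
  rw [this, Complex.ofReal_re]

lemma toda_weyl (u v : OrthonormalBasis (Fin m) ℂ E) (A B : E →ₗ[ℂ] E) (lam mu : Fin m → ℝ)
    (hA : ∀ i, A (u i) = (lam i : ℂ) • u i) (hB : ∀ i, B (v i) = (mu i : ℂ) • v i)
    (hl : Monotone lam) (hm : Monotone mu) (ε : ℝ) (hε : ∀ x, ‖A x - B x‖ ≤ ε * ‖x‖)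
    (i : Fin m) : lam i ≤ mu i + ε := by
  have : FiniteDimensional ℂ E := u.toBasis.finiteDimensional_of_finite
  let T : E →ₗ[ℂ] ({j : Fin m // j ≠ i} → ℂ) := LinearMap.pi fun j =>
    if j.1 < i then (innerSL ℂ (u j)).toLinearMap else (innerSL ℂ (v j)).toLinearMap
  have hT : LinearMap.ker T ≠ ⊥ := by
    apply LinearMap.ker_ne_bot_of_finrank_lt
    rw [Module.finrank_fintype_fun_eq_card, Module.finrank_eq_card_basis u.toBasis]
    simp
    exact i.pos
  obtain ⟨x, hx, hx0⟩ := (Submodule.ne_bot_iff _).1 hT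
  have hTx : ∀ j (h : j ≠ i), T x ⟨j, h⟩ = 0 := by
    intro j h
    rw [LinearMap.mem_ker.1 hx]; rfl
  have h1 : ∀ j, j < i → inner ℂ (u j) x = 0 := by
    intro j hj
    have := hTx j hj.ne
    simpa [T, hj] using this
  have h2 : ∀ j, i < j → inner ℂ (v j) x = 0 := by
    intro j hj
    have := hTx j hj.ne'
    simpa [T, not_lt.2 hj.le] using this
  have q1 : lam i * ‖x‖ ^ 2 ≤ (inner ℂ x (A x)).re := by
    rw [toda_quad u A lam hA, ← u.sum_sq_norm_inner_right x, Finset.mul_sum]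
    refine Finset.sum_le_sum fun j _ => ?_
    rcases lt_or_ge j i with h | h
    · simp [h1 j h]
    · exact mul_le_mul_of_nonneg_right (hl h) (by positivity)
  have q2 : (inner ℂ x (B x)).re ≤ mu i * ‖x‖ ^ 2 := by
    rw [toda_quad v B mu hB, ← v.sum_sq_norm_inner_right x, Finset.mul_sum]
    refine Finset.sum_le_sum fun j _ => ?_
    rcases lt_or_ge i j with h | h
    · simp [h2 j h]
    · exact mul_le_mul_of_nonneg_right (hm h) (by positivity)
  have q3 : (inner ℂ x (A x)).re - (inner ℂ x (B x)).re ≤ ‖x‖ * (ε * ‖x‖) := by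
    rw [← Complex.sub_re, ← inner_sub_right]
    exact (Complex.re_le_norm _).trans ((norm_inner_le_norm _ _).trans
      (mul_le_mul_of_nonneg_left (hε x) (norm_nonneg _)))
  have hpos : 0 < ‖x‖ ^ 2 := by positivity
  nlinarith

lemma toda_perturb (u v : OrthonormalBasis (Fin m) ℂ E) (A B : E →ₗ[ℂ] E) (lam mu : Fin m → ℝ)
    (hA : ∀ i, A (u i) = (lam i : ℂ) • u i) (hB : ∀ i, B (v i) = (mu i : ℂ) • v i)
    (hl : Monotone lam) (hm : Monotone mu) (ε δ G m0 : ℝ) (hε : ∀ x, ‖A x - B x‖ ≤ ε * ‖x‖)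
    (hε0 : 0 ≤ ε) (hδ0 : 0 ≤ δ) (hG : 0 < G) (p q : Fin m) (hpq : p ≠ q) (hp : mu p = m0)
    (hq : mu q = m0) (hgap : ∀ k, k ≠ p → k ≠ q → G ≤ |mu k - m0|)
    (hδ : ∀ k l, (k = p ∨ k = q) → (l = p ∨ l = q) →
      ‖inner ℂ (v k) (A (v l) - B (v l))‖ ≤ δ) (i : Fin m) (hi : i = p ∨ i = q) :
    |lam i - m0| ≤ 2 * δ + 8 * ε ^ 2 / G := by
  have hmi : mu i = m0 := by rcases hi with h | h <;> rw [h] <;> assumption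
  have hw : |lam i - m0| ≤ ε := by
    have e1 := toda_weyl u v A B lam mu hA hB hl hm ε hε i
    have e2 := toda_weyl v u B A mu lam hB hA hm hl ε (by
      intro x; rw [norm_sub_rev]; exact hε x) i
    rw [abs_le]; constructor <;> linarith
  have hG8 : 0 ≤ 8 * ε ^ 2 / G := by positivity
  rcases lt_or_ge (G / 8) ε with hc | hc
  · have : ε ≤ 8 * ε ^ 2 / G := by
      rw [le_div_iff₀ hG]; nlinarith
    linarith
  set L := lam i with hL
  set x := u i with hx
  set D : E →ₗ[ℂ] E := A - B with hD
  have hDn : ∀ y, ‖D y‖ ≤ ε * ‖y‖ := fun y => by simpa [hD] using hε y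
  have hxn : ‖x‖ = 1 := u.orthonormal.1 i
  -- key relation
  have key : ∀ k, ((L - mu k : ℝ) : ℂ) * inner ℂ (v k) x = inner ℂ (v k) (D x) := by
    intro k
    rw [hD, LinearMap.sub_apply, inner_sub_right, toda_inner_eig v B mu hB, hx, hA,
      inner_smul_right]
    push_cast; ring
  set c := fun k => inner ℂ (v k) x with hcdef
  set r : E := x - c p • v p - c q • v q with hr
  have hrk : ∀ k, inner ℂ (v k) r = if k = p ∨ k = q then 0 else c k := by
    intro k
    have := v.inner_eq_ite
    rw [hr, inner_sub_right, inner_sub_right, inner_smul_right, inner_smul_right,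
      v.inner_eq_ite, v.inner_eq_ite]
    by_cases h1 : k = p
    · subst h1; simp [hpq, hcdef]
    · by_cases h2 : k = q
      · subst h2; simp [h1, hcdef]
      · simp [h1, h2, hcdef]
  have hrn : ‖r‖ ≤ 2 * ε / G := by
    have hsq : ‖r‖ ^ 2 ≤ (2 * ε / G) ^ 2 := by
      have hDx : ∑ k, ‖inner ℂ (v k) (D x)‖ ^ 2 ≤ ε ^ 2 := by
        rw [v.sum_sq_norm_inner_right]
        have := hDn x
        rw [hxn, mul_one] at this
        gcongr
      have : ∑ k, ‖inner ℂ (v k) r‖ ^ 2 ≤ ∑ k, (2 / G) ^ 2 * ‖inner ℂ (v k) (D x)‖ ^ 2 := by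
        refine Finset.sum_le_sum fun k _ => ?_
        rw [hrk]
        split_ifs with h
        · simp; positivity
        · push Not at h
          rw [← key, norm_mul, Complex.norm_real, Real.norm_eq_abs, mul_pow, ← mul_assoc,
            ← mul_pow]
          have g1 := hgap k h.1 h.2
          have g2 : G / 2 ≤ |L - mu k| := by
            have : |mu k - m0| ≤ |L - mu k| + |L - m0| := by
              rw [abs_sub_comm L (mu k)]
              simpa using abs_sub_le (mu k) L m0
            linarith
          have g3 : 1 ≤ 2 / G * |L - mu k| := by
            rw [div_mul_eq_mul_div, le_div_iff₀ hG]; linarith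
          have g4 : 1 ≤ (2 / G * |L - mu k|) ^ 2 := one_le_pow₀ g3
          nlinarith [sq_nonneg ‖c k‖]
      rw [v.sum_sq_norm_inner_right, ← Finset.mul_sum] at this
      calc ‖r‖ ^ 2 ≤ (2 / G) ^ 2 * ε ^ 2 := this.trans (by gcongr)
        _ = _ := by ring
    exact le_of_sq_le_sq hsq (by positivity)
  have hr4 : ‖r‖ ≤ 1 / 4 := hrn.trans (by rw [div_le_iff₀ hG]; linarith)
  have hxr : x = c p • v p + c q • v q + r := by rw [hr]; abel
  have hT : 3 / 4 ≤ ‖c p‖ + ‖c q‖ := by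
    have : ‖x‖ ≤ ‖c p‖ + ‖c q‖ + ‖r‖ := by
      rw [hxr]
      refine (norm_add_le _ _).trans (add_le_add_left ((norm_add_le _ _).trans ?_) _)
      rw [norm_smul, norm_smul, v.orthonormal.1, v.orthonormal.1]; simp
    linarith
  have hk : ∀ k, (k = p ∨ k = q) → |L - m0| * ‖c k‖ ≤ δ * (‖c p‖ + ‖c q‖) + ε * ‖r‖ := by
    intro k hk
    have hmk : mu k = m0 := by rcases hk with h | h <;> rw [h] <;> assumption
    have e := congrArg norm (key k)
    rw [norm_mul, Complex.norm_real, Real.norm_eq_abs, hmk] at e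
    have e' : |L - m0| * ‖c k‖ = ‖inner ℂ (v k) (D x)‖ := e
    rw [e']
    have hDx : inner ℂ (v k) (D x) = c p * inner ℂ (v k) (D (v p)) +
        c q * inner ℂ (v k) (D (v q)) + inner ℂ (v k) (D r) := by
      conv_lhs => rw [hxr]
      simp only [map_add, map_smul, inner_add_right, inner_smul_right]
    rw [hDx]
    have b1 : ‖inner ℂ (v k) (D (v p))‖ ≤ δ := hδ k p hk (Or.inl rfl)
    have b2 : ‖inner ℂ (v k) (D (v q))‖ ≤ δ := hδ k q hk (Or.inr rfl)
    have b3 : ‖inner ℂ (v k) (D r)‖ ≤ ε * ‖r‖ := by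
      refine (norm_inner_le_norm _ _).trans ?_
      rw [v.orthonormal.1, one_mul]; exact hDn r
    refine (norm_add₃_le).trans ?_
    rw [norm_mul, norm_mul]
    have := mul_le_mul_of_nonneg_left b1 (norm_nonneg (c p))
    have := mul_le_mul_of_nonneg_left b2 (norm_nonneg (c q))
    linarith
  have s1 := hk p (Or.inl rfl)
  have s2 := hk q (Or.inr rfl)
  set T := ‖c p‖ + ‖c q‖
  have s3 : (|L - m0| - 2 * δ) * T ≤ 2 * (ε * ‖r‖) := by
    have : |L - m0| * T ≤ 2 * (δ * T + ε * ‖r‖) := by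
      simp only [T] at *; linarith
    linarith
  have s4 : 2 * (ε * ‖r‖) ≤ 4 * ε ^ 2 / G := by
    calc 2 * (ε * ‖r‖) ≤ 2 * (ε * (2 * ε / G)) := by gcongr
      _ = _ := by ring
  have e48 : 8 * ε ^ 2 / G = 2 * (4 * ε ^ 2 / G) := by ring
  by_contra hcon
  push Not at hcon
  have : 8 * ε ^ 2 / G < |L - m0| - 2 * δ := by linarith
  nlinarith
end Abstract

section Mat

lemma toda_eigenbasis {m : ℕ} (Q : Matrix (Fin m) (Fin m) ℝ) (hQ : Q.IsSymm) (lam : Fin m → ℝ)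
    (h : IsEvalEnum Q lam) :
    ∃ u : OrthonormalBasis (Fin m) ℂ (EuclideanSpace ℂ (Fin m)),
      ∀ i, Matrix.toEuclideanLin (Q.map (fun x : ℝ => (x : ℂ))) (u i) = (lam i : ℂ) • u i := by
  set Qc : Matrix (Fin m) (Fin m) ℂ := Q.map (fun x : ℝ => (x : ℂ)) with hQc
  have hH : Qc.IsHermitian := by
    ext i j
    simp [hQc, Matrix.conjTranspose_apply, hQ.apply i j]
  set ev := hH.eigenvalues with hev
  have hchar : Qc.charpoly = ∏ i, (Polynomial.X - Polynomial.C (lam i : ℂ)) := by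
    have : Qc = Q.map (Complex.ofRealHom) := rfl
    rw [this, Matrix.charpoly_map, h.2, Polynomial.map_prod]
    simp
  have hms : (Finset.univ.val.map lam : Multiset ℝ) = Finset.univ.val.map ev := by
    have r1 := hH.roots_charpoly_eq_eigenvalues
    rw [hchar, Polynomial.roots_prod _ _ (by
      simp [Finset.prod_ne_zero_iff, Polynomial.X_sub_C_ne_zero])] at r1
    have r2 := congrArg (Multiset.map Complex.re) r1
    simpa [Multiset.map_map, Function.comp_def] using r2
  have hperm : lam = ev ∘ Tuple.sort ev := by
    have hs : Monotone (ev ∘ Tuple.sort ev) := Tuple.monotone_sort ev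
    have hp : (List.ofFn lam).Perm (List.ofFn (ev ∘ Tuple.sort ev)) := by
      refine List.Perm.trans ?_ (Equiv.Perm.ofFn_comp_perm (Tuple.sort ev) ev).symm
      rw [← Multiset.coe_eq_coe, ← Fin.univ_val_map, ← Fin.univ_val_map]
      exact hms
    have := hp.eq_of_sortedLE h.1.sortedLE_ofFn hs.sortedLE_ofFn
    exact List.ofFn_injective this
  refine ⟨hH.eigenvectorBasis.reindex (Tuple.sort ev).symm, fun i => ?_⟩
  have e := hH.mulVec_eigenvectorBasis (Tuple.sort ev i)
  have hli : lam i = ev (Tuple.sort ev i) := congrFun hperm i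
  rw [OrthonormalBasis.reindex_apply, Equiv.symm_symm, hli]
  ext j
  have := congrFun e j
  simpa [Matrix.toLpLin_apply] using this

variable {m : ℕ} [NeZero m]

def todaJ (b a : Fin m → ℝ) : Matrix (Fin m) (Fin m) ℂ :=
  Matrix.of fun i j => (if i = j then (b i : ℂ) else 0) + (if j = i + 1 then (a i : ℂ) else 0) +
    (if j = i - 1 then (a (i - 1) : ℂ) else 0)

lemma todaJ_apply (b a : Fin m → ℝ) (x : EuclideanSpace ℂ (Fin m)) (i : Fin m) :
    Matrix.toEuclideanLin (todaJ b a) x i =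
      b i * x i + a i * x (i + 1) + a (i - 1) * x (i - 1) := by
  simp [Matrix.toLpLin_apply, todaJ, Matrix.mulVec, dotProduct, add_mul, Finset.sum_add_distrib]

lemma todaJ_sub (b a b' a' : Fin m → ℝ) (x : EuclideanSpace ℂ (Fin m)) :
    Matrix.toEuclideanLin (todaJ b a) x - Matrix.toEuclideanLin (todaJ b' a') x =
      Matrix.toEuclideanLin (todaJ (b - b') (a - a')) x := by
  ext i
  rw [PiLp.sub_apply, todaJ_apply, todaJ_apply, todaJ_apply]
  simp only [Pi.sub_apply]
  push_cast; ring

lemma todaJ_norm (b a : Fin m → ℝ) (M : ℝ) (hM : 0 ≤ M) (hb : ∀ i, |b i| ≤ M) (ha : ∀ i, |a i| ≤ M)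
    (x : EuclideanSpace ℂ (Fin m)) :
    ‖Matrix.toEuclideanLin (todaJ b a) x‖ ≤ 3 * M * ‖x‖ := by
  have h : ‖Matrix.toEuclideanLin (todaJ b a) x‖ ^ 2 ≤ (3 * M * ‖x‖) ^ 2 := by
    rw [mul_pow, EuclideanSpace.norm_sq_eq, EuclideanSpace.norm_sq_eq]
    have hp : ∑ i, ‖x (i + 1)‖ ^ 2 = ∑ i, ‖x i‖ ^ 2 :=
      Equiv.sum_comp (Equiv.addRight (1 : Fin m)) (fun i => ‖x i‖ ^ 2)
    have hm : ∑ i, ‖x (i - 1)‖ ^ 2 = ∑ i, ‖x i‖ ^ 2 :=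
      Equiv.sum_comp (Equiv.subRight (1 : Fin m)) (fun i => ‖x i‖ ^ 2)
    calc ∑ i, ‖Matrix.toEuclideanLin (todaJ b a) x i‖ ^ 2
        ≤ ∑ i, 3 * M ^ 2 * (‖x i‖ ^ 2 + ‖x (i + 1)‖ ^ 2 + ‖x (i - 1)‖ ^ 2) := by
          refine Finset.sum_le_sum fun i _ => ?_
          rw [todaJ_apply]
          have e : ‖(b i * x i + a i * x (i + 1) + a (i - 1) * x (i - 1) : ℂ)‖ ≤
              M * (‖x i‖ + ‖x (i + 1)‖ + ‖x (i - 1)‖) := by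
            refine norm_add₃_le.trans ?_
            simp only [norm_mul, Complex.norm_real, Real.norm_eq_abs]
            have := mul_le_mul_of_nonneg_right (hb i) (norm_nonneg (x i))
            have := mul_le_mul_of_nonneg_right (ha i) (norm_nonneg (x (i + 1)))
            have := mul_le_mul_of_nonneg_right (ha (i - 1)) (norm_nonneg (x (i - 1)))
            linarith
          calc _ ≤ (M * (‖x i‖ + ‖x (i + 1)‖ + ‖x (i - 1)‖)) ^ 2 := by gcongr
            _ = M ^ 2 * (‖x i‖ + ‖x (i + 1)‖ + ‖x (i - 1)‖) ^ 2 := by ring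
            _ ≤ M ^ 2 * (3 * (‖x i‖ ^ 2 + ‖x (i + 1)‖ ^ 2 + ‖x (i - 1)‖ ^ 2)) := by
              gcongr
              nlinarith [sq_nonneg (‖x i‖ - ‖x (i + 1)‖), sq_nonneg (‖x i‖ - ‖x (i - 1)‖),
                sq_nonneg (‖x (i + 1)‖ - ‖x (i - 1)‖)]
            _ = _ := by ring
      _ = (3 * M) ^ 2 * ∑ i, ‖x i‖ ^ 2 := by
          rw [← Finset.mul_sum, Finset.sum_add_distrib, Finset.sum_add_distrib, hp, hm]; ring
  exact le_of_sq_le_sq h (by positivity)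

lemma toda_pow_add_one (w : ℂ) (hw : w ^ m = 1) (j : Fin m) :
    w ^ (j + 1 : Fin m).val = w ^ j.val * w := by
  rw [Fin.val_add, ← pow_eq_pow_mod _ hw, pow_add, Fin.val_one', ← pow_eq_pow_mod _ hw, pow_one]

lemma toda_pow_sub_one (w : ℂ) (hw : w ^ m = 1) (j : Fin m) :
    w ^ (j - 1 : Fin m).val = w ^ j.val * w⁻¹ := by
  have h0 : w ≠ 0 := by
    rintro rfl
    rw [zero_pow (NeZero.ne m)] at hw; exact zero_ne_one hw
  have := toda_pow_add_one w hw (j - 1)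
  rw [sub_add_cancel] at this
  rw [this]; field_simp

/-- discrete Fourier sum -/
def todaS (f : Fin m → ℝ) (w : ℂ) : ℂ := ∑ j, (f j : ℂ) * w ^ j.val

lemma todaS_parts (f : Fin m → ℝ) (w : ℂ) (hw : w ^ m = 1) (hn : ‖w‖ = 1) (K : ℝ)
    (hK : ∀ j, |f (j + 1) - f j| ≤ K) : ‖w - 1‖ * ‖todaS f w‖ ≤ m * K := by
  have e : todaS f w = ∑ j, (f (j + 1) : ℂ) * (w ^ j.val * w) := by
    rw [todaS, ← Equiv.sum_comp (Equiv.addRight (1 : Fin m))]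
    refine Finset.sum_congr rfl fun j _ => ?_
    rw [Equiv.coe_addRight, toda_pow_add_one w hw]
  have e2 : (w - 1) * todaS f w = ∑ j, ((f j - f (j + 1) : ℝ) : ℂ) * (w ^ j.val * w) := by
    rw [sub_mul, one_mul]
    conv_lhs => rw [e]
    rw [← e, todaS, Finset.mul_sum]
    conv_lhs => rw [← todaS, e, ← Finset.sum_sub_distrib]
    refine Finset.sum_congr rfl fun j _ => ?_
    push_cast; ring
  rw [← norm_mul, e2]
  refine (norm_sum_le _ _).trans ?_
  calc _ ≤ ∑ _j : Fin m, K := by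
        refine Finset.sum_le_sum fun j _ => ?_
        rw [norm_mul, norm_mul, norm_pow, hn, Complex.norm_real, Real.norm_eq_abs, abs_sub_comm]
        simpa using hK j
    _ = _ := by simp

/-- exponential vectors -/
def todaE (z : ℂ) : EuclideanSpace ℂ (Fin m) :=
  WithLp.toLp 2 fun j => ((Real.sqrt m)⁻¹ : ℝ) * z ^ j.val

lemma todaE_inner (z w : ℂ) (hz : ‖z‖ = 1) :
    inner ℂ (todaE z) (todaE w : EuclideanSpace ℂ (Fin m)) = (m : ℂ)⁻¹ * todaS (1 : Fin m → ℝ) (w / z) := by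
  have hm : (0 : ℝ) ≤ m := by positivity
  rw [PiLp.inner_apply, todaS, Finset.mul_sum]
  refine Finset.sum_congr rfl fun j _ => ?_
  have h2 : (((Real.sqrt m)⁻¹ : ℝ) : ℂ) * ((Real.sqrt m)⁻¹ : ℝ) = (m : ℂ)⁻¹ := by
    rw [← Complex.ofReal_mul, ← mul_inv, Real.mul_self_sqrt hm]; simp
  have hc : (starRingEnd ℂ) z = z⁻¹ := (Complex.inv_eq_conj hz).symm
  simp only [todaE, RCLike.inner_apply, map_mul, map_pow, hc, Complex.conj_ofReal, Pi.one_apply]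
  rw [div_pow, inv_pow, ← h2]
  push_cast
  ring

lemma todaE_J (b a : Fin m → ℝ) (z w : ℂ) (hz : ‖z‖ = 1) (hzm : z ^ m = 1) (hwm : w ^ m = 1) :
    inner ℂ (todaE z) (Matrix.toEuclideanLin (todaJ b a) (todaE w)) =
      (m : ℂ)⁻¹ * (todaS b (w / z) + w * todaS a (w / z) + z⁻¹ * todaS a (w / z)) := by
  have hm : (0 : ℝ) ≤ m := by positivity
  have hw0 : w ≠ 0 := by
    rintro rfl
    rw [zero_pow (NeZero.ne m)] at hwm; exact zero_ne_one hwm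
  have hz0 : z ≠ 0 := by
    rintro rfl
    rw [zero_pow (NeZero.ne m)] at hzm; exact zero_ne_one hzm
  have h2 : (((Real.sqrt m)⁻¹ : ℝ) : ℂ) * ((Real.sqrt m)⁻¹ : ℝ) = (m : ℂ)⁻¹ := by
    rw [← Complex.ofReal_mul, ← mul_inv, Real.mul_self_sqrt hm]; simp
  have hc : (starRingEnd ℂ) z = z⁻¹ := (Complex.inv_eq_conj hz).symm
  have hwz : (w / z) ^ m = 1 := by rw [div_pow, hwm, hzm, div_one]
  have e3 : z⁻¹ * todaS a (w / z) =
      ∑ j : Fin m, w⁻¹ * ((a (j - 1) : ℂ) * (w / z) ^ j.val) := by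
    rw [todaS, ← Equiv.sum_comp (Equiv.subRight (1 : Fin m)), Finset.mul_sum]
    refine Finset.sum_congr rfl fun j _ => ?_
    rw [Equiv.subRight_apply, toda_pow_sub_one _ hwz]
    field_simp
  rw [PiLp.inner_apply, e3, todaS, todaS, Finset.mul_sum, ← Finset.sum_add_distrib,
    ← Finset.sum_add_distrib, Finset.mul_sum]
  refine Finset.sum_congr rfl fun j _ => ?_
  rw [todaJ_apply]
  simp only [todaE, RCLike.inner_apply, map_mul, map_pow, hc, Complex.conj_ofReal]
  rw [toda_pow_add_one w hwm, toda_pow_sub_one w hwm, div_pow, inv_pow, ← h2]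
  push_cast
  ring

lemma todaE_eig (w : ℂ) (hwm : w ^ m = 1) :
    Matrix.toEuclideanLin (todaJ (0 : Fin m → ℝ) 1) (todaE w) = (w + w⁻¹) • todaE w := by
  ext j
  rw [todaJ_apply]
  simp only [todaE, PiLp.smul_apply]
  rw [toda_pow_add_one w hwm, toda_pow_sub_one w hwm]
  simp; ring

lemma todaE_orthonormal (z : Fin m → ℂ) (hz : ∀ i, ‖z i‖ = 1) (hzm : ∀ i, z i ^ m = 1)
    (hinj : Function.Injective z) :
    ∃ v : OrthonormalBasis (Fin m) ℂ (EuclideanSpace ℂ (Fin m)), ∀ i, v i = todaE (z i) := by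
  have ho : Orthonormal ℂ (fun i => (todaE (z i) : EuclideanSpace ℂ (Fin m))) := by
    rw [orthonormal_iff_ite]
    intro i j
    rw [todaE_inner _ _ (hz i)]
    have hz0 : z i ≠ 0 := by
      intro h; have := hz i; rw [h] at this; simp at this
    split_ifs with h
    · subst h
      rw [div_self hz0]
      have : (m : ℂ) ≠ 0 := by exact_mod_cast NeZero.ne m
      simp [todaS, this]
    · have hne : z j / z i ≠ 1 := by
        rw [Ne, div_eq_one_iff_eq hz0]
        intro h'; exact h (hinj h').symm
      have hp := todaS_parts (1 : Fin m → ℝ) (z j / z i) (by rw [div_pow, hzm, hzm, div_one])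
        (by rw [norm_div, hz, hz, div_one]) 0 (by intro j; simp)
      have : todaS (1 : Fin m → ℝ) (z j / z i) = 0 := by
        have h1 : 0 < ‖z j / z i - 1‖ := norm_pos_iff.2 (sub_ne_zero.2 hne)
        rw [mul_zero] at hp
        have := nonpos_of_mul_nonpos_right hp h1
        exact norm_le_zero_iff.1 this
      rw [this, mul_zero]
  let bs := basisOfOrthonormalOfCardEqFinrank ho (by simp)
  have hb : (bs : Fin m → EuclideanSpace ℂ (Fin m)) = fun i => todaE (z i) :=
    coe_basisOfOrthonormalOfCardEqFinrank ho _
  refine ⟨bs.toOrthonormalBasis (by rw [hb]; exact ho), fun i => ?_⟩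
  rw [Module.Basis.coe_toOrthonormalBasis, hb]

end Mat

section Fun

lemma toda_lip (f : ℝ → ℝ) (R : ℝ) (hf : Admissible f) (h : C2NormLe f R) (x y : ℝ) :
    |f x - f y| ≤ R * |x - y| := by
  have := Convex.norm_image_sub_le_of_norm_deriv_le (f := f) (s := Set.univ) (C := R)
    (x := y) (y := x)
    (fun z _ => (hf.1.differentiable (by norm_num)).differentiableAt) (fun z _ => by
      rw [Real.norm_eq_abs]
      have := h z
      linarith [abs_nonneg (f z), abs_nonneg (deriv (deriv f) z)]) convex_univ
      (Set.mem_univ _) (Set.mem_univ _)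
  simpa [Real.norm_eq_abs] using this

lemma toda_riemann (f : ℝ → ℝ) (R : ℝ) (hR : 0 ≤ R) (hf : Admissible f) (h : C2NormLe f R) (N : ℕ)
    (hN : 0 < N) : |∑ j ∈ Finset.range (2 * N), f (((j + 1 : ℕ) : ℝ) / N)| ≤ 2 * R := by
  have hN' : (0 : ℝ) < N := by exact_mod_cast hN
  have hc : Continuous f := hf.1.continuous
  have hint : ∀ a b : ℝ, IntervalIntegrable f MeasureTheory.volume a b :=
    fun a b => hc.intervalIntegrable a b
  have hsum : ∑ j ∈ Finset.range (2 * N), ∫ x in ((j : ℕ) : ℝ) / N..((j + 1 : ℕ) : ℝ) / N, f x = 0 := by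
    rw [intervalIntegral.sum_integral_adjacent_intervals (a := fun j : ℕ => (j : ℝ) / N)
      (fun k _ => hint _ _)]
    have e2 : (((2 * N : ℕ) : ℝ) / N) = 1 + 1 := by push_cast; field_simp; norm_num
    rw [e2]
    simp only [Nat.cast_zero, zero_div]
    rw [← intervalIntegral.integral_add_adjacent_intervals (hint 0 1) (hint 1 (1 + 1)),
      hf.2.1.intervalIntegral_add_eq 1 0, zero_add, hf.2.2, zero_add]
  have hterm : ∀ j : ℕ, |f (((j + 1 : ℕ) : ℝ) / N) -
      N * ∫ x in ((j : ℕ) : ℝ) / N..((j + 1 : ℕ) : ℝ) / N, f x| ≤ R / N := by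
    intro j
    have hlen : ((j + 1 : ℕ) : ℝ) / N - ((j : ℕ) : ℝ) / N = 1 / N := by
      push_cast; field_simp; ring
    have hle : ((j : ℕ) : ℝ) / N ≤ ((j + 1 : ℕ) : ℝ) / N := by
      have : (0 : ℝ) < 1 / N := by positivity
      linarith
    have e : f (((j + 1 : ℕ) : ℝ) / N) - N * ∫ x in ((j : ℕ) : ℝ) / N..((j + 1 : ℕ) : ℝ) / N, f x
        = N * ∫ x in ((j : ℕ) : ℝ) / N..((j + 1 : ℕ) : ℝ) / N, (f (((j + 1 : ℕ) : ℝ) / N) - f x) := by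
      rw [intervalIntegral.integral_sub (by simp) (hint _ _), intervalIntegral.integral_const,
        hlen, smul_eq_mul]
      field_simp
    have hb := intervalIntegral.norm_integral_le_of_norm_le_const (a := ((j : ℕ) : ℝ) / N)
      (b := ((j + 1 : ℕ) : ℝ) / N) (C := R * (1 / N))
      (f := fun x => f (((j + 1 : ℕ) : ℝ) / N) - f x) (by
        intro x hx
        rw [Set.uIoc_of_le hle] at hx
        rw [Real.norm_eq_abs]
        refine (toda_lip f R hf h _ _).trans ?_
        refine mul_le_mul_of_nonneg_left ?_ hR
        rw [abs_of_nonneg (by linarith [hx.2])]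
        linarith [hx.1])
    rw [hlen, Real.norm_eq_abs, abs_of_nonneg (show (0 : ℝ) ≤ 1 / N by positivity)] at hb
    rw [e, abs_mul, abs_of_pos hN']
    calc (N : ℝ) * _ ≤ N * (R * (1 / N) * (1 / N)) := by gcongr
      _ = R / N := by field_simp
  have : ∑ j ∈ Finset.range (2 * N), f (((j + 1 : ℕ) : ℝ) / N) =
      ∑ j ∈ Finset.range (2 * N), (f (((j + 1 : ℕ) : ℝ) / N) -
      N * ∫ x in ((j : ℕ) : ℝ) / N..((j + 1 : ℕ) : ℝ) / N, f x) := by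
    rw [Finset.sum_sub_distrib, ← Finset.mul_sum, hsum]; ring
  rw [this]
  refine (Finset.abs_sum_le_sum_abs _ _).trans ((Finset.sum_le_sum fun j _ => hterm j).trans ?_)
  rw [Finset.sum_const, Finset.card_range, nsmul_eq_mul]
  push_cast
  apply le_of_eq; field_simp

lemma toda_sin_ge (s t : ℝ) (h0 : 0 ≤ t) (h2 : t ≤ 2) (hs : s ≤ t) (hs' : s ≤ 2 - t) :
    s ≤ Real.sin (π * t / 2) := by
  have hpi := Real.pi_pos
  rcases le_total t 1 with h | h
  · have := Real.mul_le_sin (x := π * t / 2) (by positivity) (by nlinarith)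
    have e : 2 / π * (π * t / 2) = t := by field_simp
    linarith
  · have := Real.mul_le_sin (x := π * (2 - t) / 2) (by
      have : 0 ≤ 2 - t := by linarith
      positivity) (by nlinarith)
    have e : 2 / π * (π * (2 - t) / 2) = 2 - t := by field_simp
    have e2 : π * (2 - t) / 2 = π - π * t / 2 := by ring
    rw [e2, Real.sin_pi_sub, ← e2] at this
    linarith

lemma toda_gap (N ℓ k : ℕ) (f : ℝ) (hN : 0 < N) (hk : k ≤ N) (hne : k ≠ ℓ) (hf : 0 ≤ f)
    (h1 : f ≤ ℓ) (h2 : f ≤ N - ℓ) :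
    4 * f / (N : ℝ) ^ 2 ≤ |-2 * Real.cos ((k : ℝ) * π / N) - -2 * Real.cos ((ℓ : ℝ) * π / N)| := by
  have hN' : (0 : ℝ) < N := by exact_mod_cast hN
  have hk' : (k : ℝ) ≤ N := by exact_mod_cast hk
  have hk0 : (0 : ℝ) ≤ k := by positivity
  have e : -2 * Real.cos ((k : ℝ) * π / N) - -2 * Real.cos ((ℓ : ℝ) * π / N) =
      4 * (Real.sin (π * (((k : ℝ) + ℓ) / N) / 2) * Real.sin (π * (((k : ℝ) - ℓ) / N) / 2)) := by
    have := Real.cos_sub_cos ((k : ℝ) * π / N) ((ℓ : ℝ) * π / N)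
    have e1 : ((k : ℝ) * π / N + (ℓ : ℝ) * π / N) / 2 = π * (((k : ℝ) + ℓ) / N) / 2 := by ring
    have e2 : ((k : ℝ) * π / N - (ℓ : ℝ) * π / N) / 2 = π * (((k : ℝ) - ℓ) / N) / 2 := by ring
    rw [e1, e2] at this
    linarith
  have s1 : f / N ≤ Real.sin (π * (((k : ℝ) + ℓ) / N) / 2) := by
    apply toda_sin_ge
    · positivity
    · rw [div_le_iff₀ hN']; linarith
    · gcongr; linarith
    · rw [div_le_iff₀ hN', sub_mul, div_mul_cancel₀ _ hN'.ne']; linarith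
  have s2 : 1 / (N : ℝ) ≤ |Real.sin (π * (((k : ℝ) - ℓ) / N) / 2)| := by
    have hd : (1 : ℝ) ≤ |(k : ℝ) - ℓ| := by
      have : (1 : ℤ) ≤ |(k : ℤ) - ℓ| := Int.one_le_abs (by omega)
      exact_mod_cast this
    have hd2 : |(k : ℝ) - ℓ| ≤ N := by rw [abs_le]; constructor <;> linarith
    have hh : 1 / (N : ℝ) ≤ Real.sin (π * (|(k : ℝ) - ℓ| / N) / 2) := by
      have b1 : |(k : ℝ) - ℓ| / N ≤ 1 := by rw [div_le_iff₀ hN']; linarith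
      have b2 : 1 / (N : ℝ) ≤ 1 := by
        rw [div_le_iff₀ hN', one_mul]; exact_mod_cast hN
      apply toda_sin_ge
      · positivity
      · linarith
      · gcongr
      · linarith
    rcases abs_choice ((k : ℝ) - ℓ) with h | h
    · rw [h] at hh; exact hh.trans (le_abs_self _)
    · rw [h] at hh
      have : π * (-((k : ℝ) - ℓ) / N) / 2 = -(π * (((k : ℝ) - ℓ) / N) / 2) := by ring
      rw [this, Real.sin_neg] at hh
      exact hh.trans (neg_le_abs _)
  rw [e, abs_mul, abs_mul]
  have s1' := s1.trans (le_abs_self _)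
  calc 4 * f / (N : ℝ) ^ 2 = 4 * (f / N * (1 / N)) := by field_simp
    _ ≤ 4 * (|Real.sin (π * (((k : ℝ) + ℓ) / N) / 2)| *
        |Real.sin (π * (((k : ℝ) - ℓ) / N) / 2)|) := by gcongr
    _ = _ := by norm_num

/-- frequencies -/
def todaTau (i : ℕ) : ℤ := if i % 2 = 0 then -((i / 2 : ℕ) : ℤ) else (((i + 1) / 2 : ℕ) : ℤ)

def todaZ (N : ℕ) (i : ℕ) : ℂ := -Complex.exp (Complex.I * ((π * todaTau i / N : ℝ) : ℂ))

lemma todaZ_norm (N i : ℕ) : ‖todaZ N i‖ = 1 := by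
  rw [todaZ, norm_neg, Complex.norm_exp_I_mul_ofReal]

lemma todaZ_pow (N i : ℕ) (hN : 0 < N) : todaZ N i ^ (2 * N) = 1 := by
  have hN' : (N : ℂ) ≠ 0 := by exact_mod_cast hN.ne'
  rw [todaZ, Even.neg_pow (even_two_mul N), ← Complex.exp_nat_mul, Complex.exp_eq_one_iff]
  refine ⟨todaTau i, ?_⟩
  push_cast; field_simp

lemma todaZ_inj (N : ℕ) (hN : 0 < N) :
    Function.Injective (fun i : Fin (2 * N) => todaZ N i.val) := by
  intro i j h
  have hN' : (N : ℂ) ≠ 0 := by exact_mod_cast hN.ne'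
  have hpi : (π : ℂ) ≠ 0 := by exact_mod_cast Real.pi_ne_zero
  simp only [todaZ, neg_inj] at h
  rw [Complex.exp_eq_exp_iff_exists_int] at h
  obtain ⟨n, hn⟩ := h
  have h2 : (todaTau i : ℂ) = todaTau j + n * (2 * N) := by
    have hI : Complex.I * π ≠ 0 := mul_ne_zero Complex.I_ne_zero hpi
    apply mul_left_cancel₀ hI
    push_cast at hn
    field_simp at hn
    linear_combination (Complex.I * π) * hn
  have h3 : todaTau i = todaTau j + n * (2 * N) := by exact_mod_cast h2
  have hi := i.2
  have hj := j.2
  have bi : -(N : ℤ) < todaTau i ∧ todaTau i ≤ N := by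
    unfold todaTau; split_ifs <;> constructor <;> push_cast <;> omega
  have bj : -(N : ℤ) < todaTau j ∧ todaTau j ≤ N := by
    unfold todaTau; split_ifs <;> constructor <;> push_cast <;> omega
  have hn0 : n = 0 := by
    have : |n| < 1 := by
      by_contra hc
      push Not at hc
      have : (2 * N : ℤ) ≤ |n| * (2 * N) := by nlinarith
      have e : |n| * (2 * N : ℤ) = |n * (2 * N)| := by
        rw [abs_mul, abs_of_nonneg (by positivity : (0 : ℤ) ≤ 2 * N)]
      have e2 : n * (2 * N : ℤ) = todaTau i - todaTau j := by linarith
      rw [e, e2] at this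
      have : |todaTau i - todaTau j| < 2 * N := by rw [abs_lt]; constructor <;> linarith
      linarith
    exact Int.abs_lt_one_iff.1 this
  rw [hn0, zero_mul, add_zero] at h3
  apply Fin.ext
  unfold todaTau at h3
  split_ifs at h3 <;> omega

lemma todaZ_add_inv (N i : ℕ) :
    todaZ N i + (todaZ N i)⁻¹ = ((-2 * Real.cos ((((i + 1) / 2 : ℕ) : ℝ) * π / N) : ℝ) : ℂ) := by
  have h1 : (todaZ N i)⁻¹ = -Complex.exp (-(Complex.I * ((π * todaTau i / N : ℝ) : ℂ))) := by
    rw [todaZ, inv_neg, Complex.exp_neg]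
  have hc : Real.cos (π * todaTau i / N) = Real.cos ((((i + 1) / 2 : ℕ) : ℝ) * π / N) := by
    unfold todaTau
    split_ifs with h
    · have : (i + 1) / 2 = i / 2 := by omega
      rw [this, ← Real.cos_neg]; congr 1; rw [Int.cast_neg, Int.cast_natCast]; ring
    · congr 1; rw [Int.cast_natCast]; ring
  rw [h1, todaZ, ← hc]
  push_cast
  rw [Complex.cos]
  ring_nf

lemma todaZ_div (N ℓ : ℕ) (hN : 0 < N) (hℓ : 0 < ℓ) (f : ℝ) (hf : 0 ≤ f) (h1 : f ≤ ℓ) (h2 : f ≤ N - ℓ)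
    (i j : ℕ) (hi : i = 2 * ℓ - 1 ∨ i = 2 * ℓ) (hj : j = 2 * ℓ - 1 ∨ j = 2 * ℓ) :
    todaZ N i / todaZ N j = 1 ∨ 4 * f / N ≤ ‖todaZ N i / todaZ N j - 1‖ := by
  have hN' : (0 : ℝ) < N := by exact_mod_cast hN
  have hz0 : ∀ i, todaZ N i ≠ 0 := fun i h => by
    have := todaZ_norm N i; rw [h] at this; simp at this
  have hs : 2 * f / N ≤ Real.sin (π * (2 * ℓ / N) / 2) := by
    apply toda_sin_ge
    · positivity
    · rw [div_le_iff₀ hN']; linarith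
    · gcongr
    · rw [div_le_iff₀ hN', sub_mul, div_mul_cancel₀ _ hN'.ne']; linarith
  have hd : ∀ i j, todaZ N i / todaZ N j =
      Complex.exp (Complex.I * ((π * (todaTau i - todaTau j) / N : ℝ) : ℂ)) := by
    intro i j
    rw [todaZ, todaZ, neg_div_neg_eq, ← Complex.exp_sub]
    congr 1; push_cast; ring
  have t1 : todaTau (2 * ℓ - 1) = ℓ := by
    unfold todaTau; rw [if_neg (by omega)]; omega
  have t2 : todaTau (2 * ℓ) = -ℓ := by
    unfold todaTau; rw [if_pos (by omega)]; omega
  by_cases hij : i = j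
  · left; rw [hij, div_self (hz0 j)]
  right
  rw [hd, Complex.norm_exp_I_mul_ofReal_sub_one, Real.norm_eq_abs, abs_mul, abs_two]
  have hs' : 2 * f / N ≤ |Real.sin (π * (todaTau i - todaTau j) / N / 2)| := by
    rcases hi with rfl | rfl <;> rcases hj with rfl | rfl
    · exact absurd rfl hij
    · rw [t1, t2]
      have : π * (((ℓ : ℤ) : ℝ) - ((-ℓ : ℤ) : ℝ)) / N / 2 = π * (2 * ℓ / N) / 2 := by
        push_cast; ring
      rw [this]; exact hs.trans (le_abs_self _)
    · rw [t1, t2]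
      have : π * (((-ℓ : ℤ) : ℝ) - ((ℓ : ℤ) : ℝ)) / N / 2 = -(π * (2 * ℓ / N) / 2) := by
        push_cast; ring
      rw [this, Real.sin_neg, abs_neg]; exact hs.trans (le_abs_self _)
    · exact absurd rfl hij
  calc 4 * f / N = 2 * (2 * f / N) := by ring
    _ ≤ _ := by gcongr

lemma toda_mod_iff {m : ℕ} [NeZero m] (i j : Fin m) : j.val = (i.val + 1) % m ↔ j = i + 1 := by
  rw [Fin.ext_iff, Fin.val_add, Fin.val_one', Nat.add_mod_mod]

lemma toda_one_ne {m : ℕ} [NeZero m] (hm : 3 ≤ m) : (1 : Fin m) ≠ 0 ∧ (1 : Fin m) + 1 ≠ 0 := by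
  constructor
  · rw [Ne, Fin.ext_iff, Fin.val_one', Fin.val_zero, Nat.mod_eq_of_lt (by omega)]; omega
  · rw [Ne, Fin.ext_iff, Fin.val_add, Fin.val_one', Fin.val_zero, Nat.mod_eq_of_lt (a := 1) (by omega),
      Nat.mod_eq_of_lt (by omega)]; omega

lemma toda_Q_symm (α β : ℝ → ℝ) (N : ℕ) (hN : 3 ≤ N) : (QMat α β N).IsSymm := by
  have : NeZero (2 * N) := ⟨by omega⟩
  obtain ⟨h1, h2⟩ := toda_one_ne (m := 2 * N) (by omega)
  ext i j
  simp only [Matrix.transpose_apply, QMat, Matrix.of_apply, toda_mod_iff]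
  by_cases hij : i = j
  · subst hij; simp
  · rw [if_neg hij, if_neg (Ne.symm hij)]
    by_cases ha : i = j + 1
    · rw [if_pos ha, if_neg, if_pos ha]
      intro hb; apply h2
      have : j + (1 + 1) = j + 0 := by rw [← add_assoc, ← ha, ← hb, add_zero]
      exact add_left_cancel this
    · rw [if_neg ha, if_neg ha]

lemma toda_Q_eq (α β : ℝ → ℝ) (N : ℕ) (hN : 3 ≤ N) [NeZero (2 * N)] :
    (QMat α β N).map (fun x : ℝ => (x : ℂ)) =
      todaJ (fun i : Fin (2 * N) => β (((i.val + 1 : ℕ) : ℝ) / N) / (4 * (N : ℝ) ^ 2))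
        (fun i => 1 + α (((i.val + 1 : ℕ) : ℝ) / N) / (4 * (N : ℝ) ^ 2)) := by
  obtain ⟨h1, h2⟩ := toda_one_ne (m := 2 * N) (by omega)
  ext i j
  simp only [Matrix.map_apply, QMat, todaJ, Matrix.of_apply, toda_mod_iff]
  have hsub : j = i - 1 ↔ i = j + 1 := by rw [eq_sub_iff_add_eq, eq_comm]
  simp only [hsub]
  by_cases hij : i = j
  · subst hij
    have : ¬ i = i + 1 := fun h => h1 (by simpa using h)
    rw [if_pos rfl, if_pos rfl, if_neg this, if_neg this]; simp
  · rw [if_neg hij, if_neg hij]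
    by_cases ha : j = i + 1
    · have hb : ¬ i = j + 1 := by
        intro hb; apply h2
        have : i + (1 + 1) = i + 0 := by rw [← add_assoc, ← ha, ← hb, add_zero]
        exact add_left_cancel this
      rw [if_pos ha, if_pos ha, if_neg hb]; simp
    · rw [if_neg ha, if_neg ha]
      by_cases hb : i = j + 1
      · rw [if_pos hb, if_pos hb]
        have : i - 1 = j := by rw [hb]; simp
        rw [this]; simp
      · rw [if_neg hb, if_neg hb]; simp

lemma toda_S_bound (α : ℝ → ℝ) (R : ℝ) (hR : 0 < R) (hα : Admissible α) (h : C2NormLe α R) (N : ℕ)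
    (hN : 0 < N) [NeZero (2 * N)] (f : ℝ) (hf : 0 < f) (hfN : f ≤ N) (w : ℂ) (hn : ‖w‖ = 1)
    (hw : w ^ (2 * N) = 1) (hw1 : w = 1 ∨ 4 * f / N ≤ ‖w - 1‖) :
    ‖todaS (fun i : Fin (2 * N) => α (((i.val + 1 : ℕ) : ℝ) / N) / (4 * (N : ℝ) ^ 2)) w‖ ≤
      R / (2 * N * f) := by
  have hN' : (0 : ℝ) < N := by exact_mod_cast hN
  rcases hw1 with rfl | hw1
  · have e : todaS (fun i : Fin (2 * N) => α (((i.val + 1 : ℕ) : ℝ) / N) / (4 * (N : ℝ) ^ 2)) 1 =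
        (((∑ j ∈ Finset.range (2 * N), α (((j + 1 : ℕ) : ℝ) / N)) / (4 * (N : ℝ) ^ 2) : ℝ) : ℂ) := by
      rw [Finset.sum_range, Finset.sum_div, todaS]
      push_cast
      simp
    rw [e, Complex.norm_real, Real.norm_eq_abs, abs_div, abs_of_pos (by positivity : 0 < 4 * (N : ℝ) ^ 2)]
    have := toda_riemann α R hR.le hα h N hN
    rw [div_le_div_iff₀ (by positivity) (by positivity)]
    calc _ ≤ 2 * R * (2 * N * N) := by gcongr
      _ = _ := by ring
  · have hp := todaS_parts (fun i : Fin (2 * N) => α (((i.val + 1 : ℕ) : ℝ) / N) / (4 * (N : ℝ) ^ 2))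
      w hw hn (R / N / (4 * (N : ℝ) ^ 2)) (by
        intro j
        have e : α ((((j + 1 : Fin (2 * N)).val + 1 : ℕ) : ℝ) / N) = α ((((j.val + 1) + 1 : ℕ) : ℝ) / N) := by
          have hj := j.2
          have hv := (toda_mod_iff j (j + 1)).2 rfl
          rcases Nat.lt_or_ge (j.val + 1) (2 * N) with hlt | hge
          · rw [hv, Nat.mod_eq_of_lt hlt]
          · have hj' : j.val + 1 = 2 * N := by omega
            rw [hv, hj', Nat.mod_self]
            have := hα.2.1.nat_mul 2 (((0 + 1 : ℕ) : ℝ) / N)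
            rw [← this]
            congr 1
            push_cast; field_simp; ring
        rw [e, ← sub_div, abs_div, abs_of_pos (by positivity : 0 < 4 * (N : ℝ) ^ 2)]
        gcongr
        refine (toda_lip α R hα h _ _).trans (le_of_eq ?_)
        have : ((((j.val + 1) + 1 : ℕ) : ℝ) / N - ((j.val + 1 : ℕ) : ℝ) / N) = 1 / N := by
          push_cast; field_simp; ring
        rw [this, abs_of_pos (by positivity)]; ring)
    set X := ‖todaS (fun i : Fin (2 * N) => α (((i.val + 1 : ℕ) : ℝ) / N) / (4 * (N : ℝ) ^ 2)) w‖
    have hX : 0 ≤ X := norm_nonneg _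
    have h3 : 4 * f / N * X ≤ R / (2 * (N : ℝ) ^ 2) := by
      refine (mul_le_mul_of_nonneg_right hw1 hX).trans (hp.trans (le_of_eq ?_))
      push_cast; field_simp; norm_num
    have h4 : X ≤ R / (8 * N * f) := by
      rw [le_div_iff₀ (by positivity)]
      rw [div_mul_eq_mul_div, div_le_div_iff₀ (by positivity) (by positivity)] at h3
      have : X * (8 * N * f) * (N * N) ≤ R * (N * N) := by nlinarith
      nlinarith [mul_pos hN' hN', le_of_mul_le_mul_right this (by positivity)]
    refine h4.trans ?_
    gcongr
    norm_num

end Fun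

lemma toda_aux (F : ℕ → ℝ) (hF : ConditionF F) (R : ℝ) (hR : 0 < R) (α β : ℝ → ℝ)
    (hα : Admissible α) (hβ : Admissible β) (hα' : C2NormLe α R) (hβ' : C2NormLe β R)
    (N : ℕ) (hN : 3 ≤ N) (lam : Fin (2 * N) → ℝ) (hlam : IsEvalEnum (QMat α β N) lam)
    (ℓ : ℕ) (h1 : ⌊F N⌋₊ < ℓ) (h2 : ℓ < N - ⌊F N⌋₊) (i : Fin (2 * N))
    (hi : i.val = 2 * ℓ - 1 ∨ i.val = 2 * ℓ) :
    |lam i + 2 * Real.cos ((ℓ : ℝ) * π / N)| ≤ (3 * R / 2 + 9 * R ^ 2 / 8) / ((N : ℝ) ^ 2 * F N) := by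
  have : NeZero (2 * N) := ⟨by omega⟩
  have hN0 : 0 < N := by omega
  have hN' : (0 : ℝ) < N := by exact_mod_cast hN0
  obtain ⟨hF1, -, -, η, hη0, hη, hFN⟩ := hF
  have hf0 : 0 < F N := lt_of_lt_of_le one_pos (hF1 N)
  have hfN : F N ≤ N := by
    refine (hFN N (by omega)).trans ?_
    have : (N : ℝ) ^ η ≤ (N : ℝ) ^ (1 : ℝ) :=
      Real.rpow_le_rpow_of_exponent_le (by exact_mod_cast hN0) (by linarith)
    simpa using this
  set f := F N with hfdef
  have hfl : f ≤ ℓ := by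
    have := Nat.lt_floor_add_one f
    have : ((⌊f⌋₊ + 1 : ℕ) : ℝ) ≤ ℓ := by exact_mod_cast h1
    push_cast at this; linarith
  have hfl2 : f ≤ N - ℓ := by
    have := Nat.lt_floor_add_one f
    have h3 : ⌊f⌋₊ + 1 + ℓ ≤ N := by omega
    have : ((⌊f⌋₊ + 1 + ℓ : ℕ) : ℝ) ≤ N := by exact_mod_cast h3
    push_cast at this; linarith
  obtain ⟨u, hu⟩ := toda_eigenbasis _ (toda_Q_symm α β N hN) lam hlam
  obtain ⟨v, hv⟩ := todaE_orthonormal (fun i : Fin (2 * N) => todaZ N i.val)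
    (fun i => todaZ_norm N i) (fun i => todaZ_pow N i hN0) (todaZ_inj N hN0)
  rw [toda_Q_eq α β N hN] at hu
  set b : Fin (2 * N) → ℝ := fun i => β (((i.val + 1 : ℕ) : ℝ) / N) / (4 * (N : ℝ) ^ 2) with hb
  set a : Fin (2 * N) → ℝ := fun i => α (((i.val + 1 : ℕ) : ℝ) / N) / (4 * (N : ℝ) ^ 2) with ha
  have hdiff : ∀ x, Matrix.toEuclideanLin (todaJ b (fun i =>
      1 + α (((i.val + 1 : ℕ) : ℝ) / N) / (4 * (N : ℝ) ^ 2))) x -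
      Matrix.toEuclideanLin (todaJ 0 1) x = Matrix.toEuclideanLin (todaJ b a) x := by
    intro x
    rw [todaJ_sub]
    congr 3
    · simp
    · ext i; simp [ha]
  have hbd : ∀ g : ℝ → ℝ, C2NormLe g R → ∀ x, |g x / (4 * (N : ℝ) ^ 2)| ≤ R / (4 * (N : ℝ) ^ 2) := by
    intro g hg x
    rw [abs_div, abs_of_pos (by positivity : 0 < 4 * (N : ℝ) ^ 2)]
    gcongr
    have := hg x
    linarith [abs_nonneg (deriv g x), abs_nonneg (deriv (deriv g) x)]
  set mu : Fin (2 * N) → ℝ := fun i => -2 * Real.cos ((((i.val + 1) / 2 : ℕ) : ℝ) * π / N) with hmu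
  have hle : ∀ i : Fin (2 * N), (i.val + 1) / 2 ≤ N := fun i => by have := i.2; omega
  have hmono : Monotone mu := by
    intro i j hij
    have hij' : i.val ≤ j.val := hij
    have hc := Real.strictAntiOn_cos.antitoneOn
    have hmem : ∀ k : ℕ, k ≤ N → (k : ℝ) * π / N ∈ Set.Icc 0 π := by
      intro k hk
      have hk' : (k : ℝ) ≤ N := by exact_mod_cast hk
      have := Real.pi_pos
      refine ⟨by positivity, ?_⟩
      rw [div_le_iff₀ hN']; nlinarith
    have hkl : ((((i.val + 1) / 2 : ℕ) : ℝ)) ≤ (((j.val + 1) / 2 : ℕ) : ℝ) := by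
      exact_mod_cast Nat.div_le_div_right (by omega)
    have := hc (hmem _ (hle i)) (hmem _ (hle j)) (by
      have := Real.pi_pos
      gcongr)
    simp only [hmu]; linarith
  have hp : 2 * ℓ - 1 < 2 * N := by omega
  have hq : 2 * ℓ < 2 * N := by omega
  have hmain := toda_perturb u v _ (Matrix.toEuclideanLin (todaJ 0 1)) lam mu hu
    (fun i => by rw [hv, todaE_eig _ (todaZ_pow N i hN0), todaZ_add_inv])
    hlam.1 hmono (3 * (R / (4 * (N : ℝ) ^ 2))) (3 * R / (4 * (N : ℝ) ^ 2 * f)) (4 * f / (N : ℝ) ^ 2)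
    (-2 * Real.cos ((ℓ : ℝ) * π / N))
    (fun x => by
      rw [hdiff]
      exact todaJ_norm b a _ (by positivity) (fun i => hbd β hβ' _) (fun i => hbd α hα' _) x)
    (by positivity) (by positivity) (by positivity) ⟨2 * ℓ - 1, hp⟩ ⟨2 * ℓ, hq⟩
    (by rw [Ne, Fin.mk.injEq]; omega)
    (by
      have : (2 * ℓ - 1 + 1) / 2 = ℓ := by omega
      simp only [hmu, this])
    (by
      have : (2 * ℓ + 1) / 2 = ℓ := by omega
      simp only [hmu, this])
    (fun k hk1 hk2 => by
      rw [Ne, Fin.ext_iff] at hk1 hk2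
      simp only at hk1 hk2
      exact toda_gap N ℓ _ f hN0 (hle k) (by omega) hf0.le hfl hfl2)
    (fun k l hk hl => by
      rw [hdiff, hv, hv, todaE_J _ _ _ _ (todaZ_norm _ _) (todaZ_pow _ _ hN0) (todaZ_pow _ _ hN0)]
      have hk' : k.val = 2 * ℓ - 1 ∨ k.val = 2 * ℓ := by
        rcases hk with h | h <;> rw [h] <;> simp
      have hl' : l.val = 2 * ℓ - 1 ∨ l.val = 2 * ℓ := by
        rcases hl with h | h <;> rw [h] <;> simp
      have hw := todaZ_div N ℓ hN0 (by omega) f hf0.le hfl hfl2 _ _ hl' hk'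
      have hwn : ‖todaZ N l / todaZ N k‖ = 1 := by rw [norm_div, todaZ_norm, todaZ_norm, div_one]
      have hwp : (todaZ N l / todaZ N k) ^ (2 * N) = 1 := by
        rw [div_pow, todaZ_pow _ _ hN0, todaZ_pow _ _ hN0, div_one]
      have sb := toda_S_bound β R hR hβ hβ' N hN0 f hf0 hfN _ hwn hwp hw
      have sa := toda_S_bound α R hR hα hα' N hN0 f hf0 hfN _ hwn hwp hw
      rw [norm_mul]
      have hm : ‖(((2 * N : ℕ) : ℂ))⁻¹‖ = 1 / (2 * N) := by
        rw [norm_inv, Complex.norm_natCast]; push_cast; rw [one_div]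
      rw [hm]
      calc _ ≤ 1 / (2 * (N : ℝ)) * (3 * (R / (2 * N * f))) := by
            refine mul_le_mul_of_nonneg_left ?_ (by positivity)
            refine norm_add₃_le.trans ?_
            rw [norm_mul, norm_mul, norm_inv, todaZ_norm, todaZ_norm, inv_one, one_mul]
            linarith
        _ = _ := by field_simp; norm_num)
    i (by
      rcases hi with h | h
      · left; exact Fin.ext h
      · right; exact Fin.ext h)
  have e : lam i + 2 * Real.cos ((ℓ : ℝ) * π / N) = lam i - -2 * Real.cos ((ℓ : ℝ) * π / N) := by ring
  rw [e]
  refine hmain.trans (le_of_eq ?_)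
  field_simp
  ring

/-- Theorem 1.1, bulk. -/
theorem toda_bulk_asymptotics
    (F : ℕ → ℝ) (hF : ConditionF F) (R : ℝ) (hR : 0 < R) :
    ∃ C : ℝ, 0 < C ∧
      ∀ α β : ℝ → ℝ, Admissible α → Admissible β → C2NormLe α R → C2NormLe β R →
      ∀ N : ℕ, ∀ hN : 3 ≤ N,
      ∀ lam : Fin (2 * N) → ℝ, IsEvalEnum (QMat α β N) lam →
      ∀ ℓ : ℕ, ⌊F N⌋₊ < ℓ → ∀ hℓ : ℓ < N - ⌊F N⌋₊,
        |lam ⟨2 * ℓ - 1, by omega⟩ + 2 * Real.cos ((ℓ : ℝ) * π / N)|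
            ≤ C / ((N : ℝ) ^ 2 * F N) ∧
        |lam ⟨2 * ℓ, by omega⟩ + 2 * Real.cos ((ℓ : ℝ) * π / N)|
            ≤ C / ((N : ℝ) ^ 2 * F N) := by
  refine ⟨3 * R / 2 + 9 * R ^ 2 / 8, by positivity, ?_⟩
  intro α β hα hβ hα' hβ' N hN lam hlam ℓ h1 h2
  exact ⟨toda_aux F hF R hR α β hα hβ hα' hβ' N hN lam hlam ℓ h1 h2 _ (Or.inl rfl),
    toda_aux F hF R hR α β hα hβ hα' hβ' N hN lam hlam ℓ h1 h2 _ (Or.inr rfl)⟩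

end
end

section
/- Orthonormality of the theta basis: For every integer N ≥ 1 and all integers 0 ≤ j, k ≤ 2N − 1, ⟨θ^N_j, θ^N_k⟩ = ∫₀¹∫₀¹ θ^N_j(x + iy) · conj(θ^N_k(x + iy)) e^{−4πN y²} dx dy equals 1 if j = k and 0 otherwise. -/
noncomputable section

/-- The theta function `θ^N_j(z) = (4N)^{1/4} e^{-πj²/(2N)}
∑_{n∈ℤ} e^{-π(2Nn² + 2jn)} e^{2πiz(j+2Nn)}`. -/
def theta (N j : ℕ) (z : ℂ) : ℂ :=
  (((4 * (N : ℝ)) ^ ((1:ℝ)/4) : ℝ) : ℂ) *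
    Complex.exp (-(Real.pi : ℂ) * (j : ℂ) ^ 2 / (2 * (N : ℂ))) *
    ∑' n : ℤ, Complex.exp (-(Real.pi : ℂ) * (2 * (N : ℂ) * (n : ℂ) ^ 2 + 2 * (j : ℂ) * (n : ℂ))) *
      Complex.exp (2 * (Real.pi : ℂ) * Complex.I * z * ((j : ℂ) + 2 * (N : ℂ) * (n : ℂ)))

/-- Coefficients: weighted Gaussian. -/
def gco (N j : ℕ) (y : ℝ) (n : ℤ) : ℝ :=
  (4 * (N : ℝ)) ^ ((1:ℝ)/4) *
    Real.exp (-(2 * Real.pi * N) * (y + n + (j : ℝ) / (2 * N)) ^ 2)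

/-- Characters. -/
def chr (m : ℤ) (x : ℝ) : ℂ := Complex.exp (2 * (Real.pi : ℂ) * Complex.I * m * x)

lemma gco_nonneg (N j : ℕ) (y : ℝ) (n : ℤ) : 0 ≤ gco N j y n := by
  unfold gco; positivity

lemma norm_chr (m : ℤ) (x : ℝ) : ‖chr m x‖ = 1 := by
  have : chr m x = Complex.exp (((2 * Real.pi * m * x : ℝ) : ℂ) * Complex.I) := by
    unfold chr; push_cast; ring_nf
  rw [this, Complex.norm_exp_ofReal_mul_I]

lemma conj_chr (m : ℤ) (x : ℝ) : (starRingEnd ℂ) (chr m x) = chr (-m) x := by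
  unfold chr
  rw [← Complex.exp_conj]
  simp [map_ofNat]

lemma chr_mul (m n : ℤ) (x : ℝ) : chr m x * chr n x = chr (m + n) x := by
  unfold chr
  rw [← Complex.exp_add]
  push_cast; ring_nf

lemma continuous_chr (m : ℤ) : Continuous (chr m) := by
  unfold chr; fun_prop

lemma integral_chr (m : ℤ) : ∫ x in (0:ℝ)..1, chr m x = if m = 0 then 1 else 0 := by
  split_ifs with h
  · simp [chr, h]
  · unfold chr
    have hc : 2 * (Real.pi : ℂ) * Complex.I * m ≠ 0 := by
      simp [Real.pi_ne_zero, h]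
    rw [integral_exp_mul_complex hc]
    have : Complex.exp (2 * (Real.pi : ℂ) * Complex.I * m * (1:ℝ)) = 1 := by
      rw [Complex.exp_eq_one_iff]
      exact ⟨m, by push_cast; ring⟩
    rw [this]; simp

lemma summable_gco (N j : ℕ) (hN : 1 ≤ N) (y : ℝ) : Summable (gco N j y) := by
  have hN' : (0:ℝ) < N := by exact_mod_cast hN
  have h := (summable_jacobiTheta₂_term_iff (((2 * N * (y + (j:ℝ) / (2 * N)) : ℝ) : ℂ) * Complex.I)
    (((2 * N : ℝ) : ℂ) * Complex.I)).2 (by simp [hN'])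
  have h2 := (h.norm.mul_left (Real.exp (-(2 * Real.pi * N) * (y + (j : ℝ) / (2 * N)) ^ 2))).mul_left
    ((4 * (N : ℝ)) ^ ((1:ℝ)/4))
  refine h2.congr fun n => ?_
  rw [norm_jacobiTheta₂_term, ← Real.exp_add]
  unfold gco
  congr 2
  rw [Complex.im_ofReal_mul, Complex.im_ofReal_mul, Complex.I_im]
  ring

lemma theta_eq (N j : ℕ) (hN : 1 ≤ N) (x y : ℝ) :
    theta N j ((x : ℂ) + (y : ℂ) * Complex.I) *
      ((Real.exp (-(2 * Real.pi * N) * y ^ 2) : ℝ) : ℂ) =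
    ∑' n : ℤ, (gco N j y n : ℂ) * chr (j + 2 * N * n) x := by
  have hN' : (N:ℂ) ≠ 0 := by exact_mod_cast (by omega : N ≠ 0)
  unfold theta
  rw [← tsum_mul_left, ← tsum_mul_right]
  refine tsum_congr fun n => ?_
  unfold gco chr
  push_cast
  simp only [mul_assoc]
  congr 1
  simp only [← Complex.exp_add]
  congr 1
  have hI : Complex.I * Complex.I = -1 := Complex.I_mul_I
  field_simp
  ring_nf
  simp only [Complex.I_sq]
  ring

lemma inner_hasSum (N : ℕ) (hN : 1 ≤ N) (j k : ℕ) (y : ℝ) :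
    HasSum (fun p : ℤ × ℤ => ((gco N j y p.1 * gco N k y p.2 : ℝ) : ℂ) *
        (if (j + 2 * N * p.1 : ℤ) + -(k + 2 * N * p.2) = 0 then 1 else 0))
      (∫ x in (0:ℝ)..1,
        theta N j ((x : ℂ) + (y : ℂ) * Complex.I) *
          (starRingEnd ℂ) (theta N k ((x : ℂ) + (y : ℂ) * Complex.I)) *
          Complex.exp (-4 * (Real.pi : ℂ) * (N : ℂ) * (y : ℂ) ^ 2)) := by
  have hs : ∀ (i : ℕ) (x : ℝ),
      Summable fun n : ℤ => ‖(gco N i y n : ℂ) * chr (i + 2 * N * n) x‖ := by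
    intro i x
    refine (summable_gco N i hN y).congr fun n => ?_
    rw [norm_mul, norm_chr, mul_one, Complex.norm_real, Real.norm_of_nonneg (gco_nonneg _ _ _ _)]
  have hb : Summable fun p : ℤ × ℤ => gco N j y p.1 * gco N k y p.2 :=
    (summable_gco N j hN y).mul_of_nonneg (summable_gco N k hN y)
      (fun n => gco_nonneg _ _ _ _) (fun n => gco_nonneg _ _ _ _)
  have key := intervalIntegral.hasSum_integral_of_dominated_convergence
    (μ := MeasureTheory.volume) (a := 0) (b := 1)
    (F := fun (p : ℤ × ℤ) (x : ℝ) => ((gco N j y p.1 * gco N k y p.2 : ℝ) : ℂ) *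
      chr ((j + 2 * N * p.1 : ℤ) + -(k + 2 * N * p.2)) x)
    (f := fun x : ℝ => theta N j ((x : ℂ) + (y : ℂ) * Complex.I) *
          (starRingEnd ℂ) (theta N k ((x : ℂ) + (y : ℂ) * Complex.I)) *
          Complex.exp (-4 * (Real.pi : ℂ) * (N : ℂ) * (y : ℂ) ^ 2))
    (fun p _ => gco N j y p.1 * gco N k y p.2) ?_ ?_ ?_ ?_ ?_
  · simpa only [intervalIntegral.integral_const_mul, integral_chr] using key
  · intro p
    exact (continuous_const.mul (continuous_chr _)).aestronglyMeasurable
  · intro p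
    refine Filter.Eventually.of_forall fun x _ => ?_
    rw [norm_mul, norm_chr, mul_one, Complex.norm_real,
      Real.norm_of_nonneg (mul_nonneg (gco_nonneg _ _ _ _) (gco_nonneg _ _ _ _))]
  · exact Filter.Eventually.of_forall fun x _ => hb
  · exact intervalIntegrable_const
  · refine Filter.Eventually.of_forall fun x _ => ?_
    have h1 := (hs j x).of_norm.hasSum
    have h2 := (Complex.hasSum_conj'.2 (hs k x).of_norm.hasSum)
    rw [← theta_eq N j hN x y] at h1
    rw [← theta_eq N k hN x y] at h2
    have h2n : Summable fun n : ℤ => ‖(starRingEnd ℂ) ((gco N k y n : ℂ) * chr (k + 2 * N * n) x)‖ := by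
      simpa only [RCLike.norm_conj] using hs k x
    have h4 := summable_mul_of_summable_norm (hs j x) h2n
    have h3 := HasSum.mul h1 h2 h4
    convert h3 using 1
    · rfl
    · ext p
      rw [map_mul, conj_chr, Complex.conj_ofReal, ← chr_mul]
      push_cast; ring
    · rw [map_mul, Complex.conj_ofReal]
      have : Complex.exp (-4 * (Real.pi : ℂ) * (N : ℂ) * (y : ℂ) ^ 2) =
        ((Real.exp (-(2 * Real.pi * N) * y ^ 2) : ℝ) : ℂ) *
        ((Real.exp (-(2 * Real.pi * N) * y ^ 2) : ℝ) : ℂ) := by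
        push_cast
        rw [← Complex.exp_add]; ring_nf
      rw [this]; ring

/-- The Gaussian on the line. -/
def gau (N j : ℕ) (t : ℝ) : ℝ :=
  (4 * (N : ℝ)) ^ ((1:ℝ)/2) * Real.exp (-(4 * Real.pi * N) * (t + (j : ℝ) / (2 * N)) ^ 2)

lemma gau_eq (N j : ℕ) (y : ℝ) (n : ℤ) : gco N j y n * gco N j y n = gau N j (y + n) := by
  unfold gco gau
  have h : (4 * (N : ℝ)) ^ ((1:ℝ)/2) = (4 * (N : ℝ)) ^ ((1:ℝ)/4) * (4 * (N : ℝ)) ^ ((1:ℝ)/4) := by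
    rw [← Real.rpow_add_of_nonneg (by positivity) (by norm_num) (by norm_num)]; norm_num
  rw [h, mul_mul_mul_comm, ← Real.exp_add]
  ring_nf

lemma gau_integrable (N j : ℕ) (hN : 1 ≤ N) : MeasureTheory.Integrable (gau N j) := by
  have hN' : (0:ℝ) < N := by exact_mod_cast hN
  exact ((integrable_exp_neg_mul_sq (b := 4 * Real.pi * N) (by positivity)).comp_add_right
    ((j : ℝ) / (2 * N))).const_mul _

lemma gau_integral (N j : ℕ) (hN : 1 ≤ N) : ∫ t, gau N j t = 1 := by
  have hN' : (0:ℝ) < N := by exact_mod_cast hN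
  unfold gau
  rw [MeasureTheory.integral_const_mul,
    MeasureTheory.integral_add_right_eq_self
      (fun t : ℝ => Real.exp (-(4 * Real.pi * N) * t ^ 2)) ((j : ℝ) / (2 * N)),
    integral_gaussian, ← Real.sqrt_eq_rpow, ← Real.sqrt_mul (by positivity)]
  rw [Real.sqrt_eq_one]
  field_simp

lemma gau_tsum (N j : ℕ) (hN : 1 ≤ N) :
    ∫ y in (0:ℝ)..1, ∑' n : ℤ, gau N j (y + n) = 1 := by
  have h := (gau_integrable N j hN).hasSum_intervalIntegral_comp_add_int
  rw [gau_integral N j hN] at h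
  simp only [intervalIntegral.integral_of_le zero_le_one] at h ⊢
  refine Eq.trans (Eq.symm ?_) h.tsum_eq
  refine MeasureTheory.integral_tsum_of_summable_integral_norm
    (F := fun (n : ℤ) (y : ℝ) => gau N j (y + n)) ?_ ?_
  · intro n
    exact ((gau_integrable N j hN).comp_add_right (n : ℝ)).restrict
  · refine h.summable.congr fun n => ?_
    congr 1
    ext y
    rw [Real.norm_of_nonneg]
    unfold gau; positivity

/-- Orthonormality of the theta basis `(θ^N_j)_{0 ≤ j ≤ 2N-1}` for the weighted
inner product `⟨f,g⟩ = ∫₀¹∫₀¹ f(x+iy) conj(g(x+iy)) e^{-4πNy²} dx dy`. -/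
theorem theta_orthonormal (N : ℕ) (hN : 1 ≤ N) (j k : ℕ)
    (hj : j ≤ 2 * N - 1) (hk : k ≤ 2 * N - 1) :
    (∫ y in (0:ℝ)..1, ∫ x in (0:ℝ)..1,
        theta N j ((x : ℂ) + (y : ℂ) * Complex.I) *
          (starRingEnd ℂ) (theta N k ((x : ℂ) + (y : ℂ) * Complex.I)) *
          Complex.exp (-4 * (Real.pi : ℂ) * (N : ℂ) * (y : ℂ) ^ 2))
      = if j = k then 1 else 0 := by
  by_cases hjk : j = k
  · subst hjk
    rw [if_pos rfl]
    have h : ∀ y : ℝ, (∫ x in (0:ℝ)..1,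
        theta N j ((x : ℂ) + (y : ℂ) * Complex.I) *
          (starRingEnd ℂ) (theta N j ((x : ℂ) + (y : ℂ) * Complex.I)) *
          Complex.exp (-4 * (Real.pi : ℂ) * (N : ℂ) * (y : ℂ) ^ 2)) =
        ((∑' n : ℤ, gau N j (y + n) : ℝ) : ℂ) := by
      intro y
      have h1 := inner_hasSum N hN j j y
      have hinj : Function.Injective (fun n : ℤ => (n, n)) := fun a b hab => (Prod.ext_iff.1 hab).1
      rw [← hinj.hasSum_iff] at h1
      · rw [← h1.tsum_eq, Complex.ofReal_tsum]
        refine tsum_congr fun n => ?_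
        simp [← gau_eq]
      · rintro ⟨n, m⟩ hnm
        have hne : n ≠ m := fun e => hnm ⟨n, by simp [e]⟩
        have : (j + 2 * N * n : ℤ) + -(j + 2 * N * m) ≠ 0 := by
          intro e
          have e2 : (2 * N : ℤ) * (n - m) = 0 := by linarith
          rcases mul_eq_zero.1 e2 with e3 | e3
          · omega
          · exact hne (by omega)
        simp only [if_neg this, mul_zero]
    simp only [h]
    rw [intervalIntegral.integral_ofReal, gau_tsum N j hN, Complex.ofReal_one]
  · rw [if_neg hjk]
    have h : ∀ y : ℝ, (∫ x in (0:ℝ)..1,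
        theta N j ((x : ℂ) + (y : ℂ) * Complex.I) *
          (starRingEnd ℂ) (theta N k ((x : ℂ) + (y : ℂ) * Complex.I)) *
          Complex.exp (-4 * (Real.pi : ℂ) * (N : ℂ) * (y : ℂ) ^ 2)) = 0 := by
      intro y
      rw [← (inner_hasSum N hN j k y).tsum_eq]
      convert tsum_zero with p
      have : (j + 2 * N * p.1 : ℤ) + -(k + 2 * N * p.2) ≠ 0 := by
        intro e
        have e2 : (j : ℤ) - k = (2 * N : ℤ) * (p.2 - p.1) := by linarith
        have e3 : (j : ℤ) - k = 0 := by
          refine Int.eq_zero_of_abs_lt_dvd (m := 2 * N) ⟨_, e2⟩ ?_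
          rw [abs_lt]; constructor <;> omega
        omega
      simp only [if_neg this, mul_zero]
    simp only [h, intervalIntegral.integral_zero]

end
end

section
/- Two-sided bounds for the partial cosine product, lower range (Lemma A.3): There exists a constant c > 0 such that for all integers M, N with 1 ≤ M < N: (π²/(2N²))^M (M!)² ≥ ∏_{n=1}^{M} (1 − cos(nπ/N)) ≥ (π²/(2N²))^M (M!)² · exp(−c M³/N²). -/
open scoped Real

lemma aux_fact (M : ℕ) : ∏ n ∈ Finset.Icc 1 M, n = M.factorial := by
  induction M with
  | zero => simp
  | succ k ih => rw [Finset.prod_Icc_succ_top (by omega), ih, Nat.factorial_succ, mul_comm]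

lemma aux_lower (x : ℝ) (h0 : 0 ≤ x) (h1 : x ≤ π) :
    x ^ 2 / 2 * Real.exp (-2 * x ^ 2) ≤ 1 - Real.cos x := by
  have he : Real.exp (-2 * x ^ 2) ≤ 1 / (1 + 2 * x ^ 2) := by
    rw [neg_mul, Real.exp_neg, ← one_div]
    apply one_div_le_one_div_of_le (by positivity)
    linarith [Real.add_one_le_exp (2 * x ^ 2)]
  refine (mul_le_mul_of_nonneg_left he (by positivity)).trans ?_
  have hx2 : 0 ≤ x ^ 2 := by positivity
  rcases le_total x 1 with h | h
  · have hb := Real.cos_bound (x := x) (by rw [abs_of_nonneg h0]; exact h)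
    rw [abs_of_nonneg h0] at hb
    have hb2 := (abs_le.mp hb).2
    have hu : x ^ 2 ≤ 1 := by nlinarith
    have h3 : x ^ 2 / 2 * (1 / (1 + 2 * x ^ 2)) ≤ x ^ 2 / 2 - x ^ 4 * (5 / 96) := by
      rw [mul_one_div, div_le_iff₀ (by positivity)]
      have h4 : 0 ≤ x ^ 4 * (1 - x ^ 2) := mul_nonneg (by positivity) (by linarith)
      have h5 : 0 ≤ x ^ 4 := by positivity
      nlinarith
    linarith
  · have hc := Real.cos_le_one_sub_mul_cos_sq (x := x) (by rw [abs_of_nonneg h0]; exact h1)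
    have h3 : 1 / (1 + 2 * x ^ 2) ≤ 1 / 3 :=
      one_div_le_one_div_of_le (by norm_num) (by nlinarith)
    have h4 : (1 : ℝ) / 6 ≤ 2 / π ^ 2 := by
      rw [div_le_div_iff₀ (by norm_num) (by positivity)]
      nlinarith [Real.pi_lt_d2, Real.pi_pos]
    nlinarith

/-- Lemma A.3: two-sided bounds for `∏_{n=1}^M (1 - cos(nπ/N))`, `1 ≤ M < N`. -/
theorem partial_cosine_product_lower_range :
    ∃ c : ℝ, 0 < c ∧ ∀ M N : ℕ, 1 ≤ M → M < N →
      (∏ n ∈ Finset.Icc 1 M, (1 - Real.cos ((n : ℝ) * π / N)))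
          ≤ (π ^ 2 / (2 * (N : ℝ) ^ 2)) ^ M * ((M.factorial : ℝ)) ^ 2 ∧
      (π ^ 2 / (2 * (N : ℝ) ^ 2)) ^ M * ((M.factorial : ℝ)) ^ 2 *
            Real.exp (-c * (M : ℝ) ^ 3 / (N : ℝ) ^ 2)
          ≤ ∏ n ∈ Finset.Icc 1 M, (1 - Real.cos ((n : ℝ) * π / N)) := by
  refine ⟨2 * π ^ 2, by positivity, fun M N hM hMN => ?_⟩
  have hN : (0 : ℝ) < N := by exact_mod_cast (by omega : 0 < N)
  have hprod : (π ^ 2 / (2 * (N : ℝ) ^ 2)) ^ M * ((M.factorial : ℝ)) ^ 2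
      = ∏ n ∈ Finset.Icc 1 M, ((n : ℝ) * π / N) ^ 2 / 2 := by
    rw [← aux_fact]
    push_cast
    rw [← Finset.prod_pow]
    have : (π ^ 2 / (2 * (N : ℝ) ^ 2)) ^ M
        = ∏ n ∈ Finset.Icc 1 M, (π ^ 2 / (2 * (N : ℝ) ^ 2)) := by
      rw [Finset.prod_const, Nat.card_Icc, Nat.add_sub_cancel]
    rw [this, ← Finset.prod_mul_distrib]
    refine Finset.prod_congr rfl fun n _ => ?_
    field_simp
  have hexp : Real.exp (-(2 * π ^ 2) * (M : ℝ) ^ 3 / (N : ℝ) ^ 2)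
      = ∏ n ∈ Finset.Icc 1 M, Real.exp (-2 * ((M : ℝ) * π / N) ^ 2) := by
    rw [Finset.prod_const, Nat.card_Icc, Nat.add_sub_cancel, ← Real.exp_nat_mul]
    congr 1
    field_simp
  rw [hprod, hexp]
  refine ⟨Finset.prod_le_prod (fun n _ => by linarith [Real.cos_le_one ((n : ℝ) * π / N)])
    (fun n _ => by linarith [Real.one_sub_sq_div_two_le_cos (x := (n : ℝ) * π / N)]), ?_⟩
  rw [← Finset.prod_mul_distrib]
  refine Finset.prod_le_prod (fun n _ => by positivity) fun n hn => ?_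
  have hnM : (n : ℝ) ≤ M := by exact_mod_cast (Finset.mem_Icc.mp hn).2
  have hMN' : (M : ℝ) ≤ N := by exact_mod_cast hMN.le
  refine le_trans ?_ (aux_lower ((n : ℝ) * π / N) (by positivity) ?_)
  · have : ((n : ℝ) * π / N) ^ 2 ≤ ((M : ℝ) * π / N) ^ 2 := by gcongr
    refine mul_le_mul_of_nonneg_left (Real.exp_le_exp.mpr (by linarith)) (by positivity)
  · rw [div_le_iff₀ hN]
    nlinarith [Real.pi_pos]
end
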